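/- Let g : (0, ∞) → (0, ∞) and let (m(·, t))_{t > 0} be a jointly measurable family of probability densities on (0, ∞) satisfying the Laplace-transform law ∫_0^∞ e^{-θt} m(s, t) dt = (g(θ)/θ) e^{-s g(θ)} for all s > 0 and θ > 0. Let f ∈ A(D) with Taylor coefficients (a_k), and set ℓ_g(u, t) := ∫_0^∞ (2πy)^{-1/2} e^{-u²/(2y)} m(y, t) dy. Then for every θ > 0 and every z with |z| ≤ 1, ∫_0^∞ e^{-θt} (∫_ℝ f(z e^{-iu}) ℓ_g(u, t) du) dt = ∑_{k=0}^∞ a_k z^k (g(θ)/θ) / (g(θ) + k²/2), the series converging absolutely. -/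

import Mathlib

open MeasureTheory Real Complex

/-- The centred Gaussian density of variance `y` at the point `u`. -/
noncomputable def heatKernel (y u : ℝ) : ℝ :=
  (Real.sqrt (2 * Real.pi * y))⁻¹ * Real.exp (-u ^ 2 / (2 * y))

lemma heatKernel_nonneg (y u : ℝ) : 0 ≤ heatKernel y u := by
  unfold heatKernel; positivity

lemma heatKernel_eq_gaussianPDFReal {y : ℝ} (hy : 0 < y) :
    heatKernel y = ProbabilityTheory.gaussianPDFReal 0 y.toNNReal := by
  ext u
  simp [heatKernel, ProbabilityTheory.gaussianPDFReal, Real.coe_toNNReal y hy.le]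

lemma measurable_uncurry_heatKernel : Measurable (Function.uncurry heatKernel) := by
  unfold heatKernel Function.uncurry
  fun_prop

lemma integrable_heatKernel {y : ℝ} (hy : 0 < y) : Integrable (heatKernel y) := by
  rw [heatKernel_eq_gaussianPDFReal hy]
  exact ProbabilityTheory.integrable_gaussianPDFReal _ _

lemma integral_heatKernel {y : ℝ} (hy : 0 < y) : ∫ u, heatKernel y u = 1 := by
  rw [heatKernel_eq_gaussianPDFReal hy]
  exact ProbabilityTheory.integral_gaussianPDFReal_eq_one 0 (by simpa using hy)

lemma integral_exp_pow_mul_heatKernel {y : ℝ} (hy : 0 < y) (k : ℕ) :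
    ∫ u : ℝ, Complex.exp (-Complex.I * (u : ℂ)) ^ k * (heatKernel y u : ℂ) =
      ((Real.exp (-((k : ℝ) ^ 2 / 2) * y) : ℝ) : ℂ) := by
  have hv : y.toNNReal ≠ 0 := by simpa using hy
  have h := ProbabilityTheory.charFun_gaussianReal (μ := 0) (v := y.toNNReal) (-(k : ℝ))
  rw [charFun_apply_real, ProbabilityTheory.integral_gaussianReal_eq_integral_smul hv,
    ← heatKernel_eq_gaussianPDFReal hy, Real.coe_toNNReal y hy.le] at h
  calc _ = _ := integral_congr_ae (Filter.Eventually.of_forall fun u => ?_)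
    _ = _ := h
    _ = _ := ?_
  · simp only [Complex.real_smul, ← Complex.exp_nat_mul]
    rw [mul_comm]
    congr 2
    push_cast
    ring
  · push_cast
    congr 1
    ring

lemma norm_exp_neg_I_mul (u : ℝ) : ‖Complex.exp (-Complex.I * (u : ℂ))‖ = 1 := by
  have h := Complex.norm_exp_ofReal_mul_I (-u)
  rwa [show ((-u : ℝ) : ℂ) * Complex.I = -Complex.I * (u : ℂ) by push_cast; ring] at h

lemma norm_mul_exp_neg_I_mul (z : ℂ) (u : ℝ) :
    ‖z * Complex.exp (-Complex.I * (u : ℂ))‖ = ‖z‖ := by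
  rw [norm_mul, norm_exp_neg_I_mul, mul_one]

/-- Lebesgue measure on `(0, ∞) × ℝ`. -/
noncomputable def halfPlaneMeasure : Measure (ℝ × ℝ) :=
  (volume.restrict (Set.Ioi (0 : ℝ))).prod volume

/-- The joint density of variance and position for the heat kernel damped at rate `c`. -/
noncomputable def resolventDensity (c : ℝ) (p : ℝ × ℝ) : ℝ :=
  Real.exp (-c * p.1) * heatKernel p.1 p.2

lemma resolventDensity_nonneg (c : ℝ) (p : ℝ × ℝ) : 0 ≤ resolventDensity c p :=
  mul_nonneg (Real.exp_pos _).le (heatKernel_nonneg _ _)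

lemma measurable_resolventDensity (c : ℝ) : Measurable (resolventDensity c) := by
  have := measurable_uncurry_heatKernel
  exact Measurable.mul (by fun_prop) this

lemma integrable_resolventDensity {c : ℝ} (hc : 0 < c) :
    Integrable (resolventDensity c) halfPlaneMeasure := by
  refine (integrable_prod_iff (measurable_resolventDensity c).aestronglyMeasurable).2 ⟨?_, ?_⟩
  · filter_upwards [ae_restrict_mem measurableSet_Ioi] with y hy
    exact (integrable_heatKernel hy).const_mul (Real.exp (-c * y))
  · refine (integrableOn_exp_mul_Ioi (neg_lt_zero.2 hc) 0).congr ?_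
    filter_upwards [ae_restrict_mem measurableSet_Ioi] with y hy
    simp only [Real.norm_of_nonneg (resolventDensity_nonneg c _)]
    simp only [resolventDensity]
    rw [integral_const_mul, integral_heatKernel hy, mul_one]

lemma integrable_mul_resolventDensity {c : ℝ} (hc : 0 < c) {F : ℝ → ℂ} (hF : Continuous F)
    {C : ℝ} (hC : ∀ u, ‖F u‖ ≤ C) :
    Integrable (fun p : ℝ × ℝ => F p.2 * (resolventDensity c p : ℂ)) halfPlaneMeasure :=
  (integrable_resolventDensity hc).ofReal.bdd_mul
    (hF.comp continuous_snd).aestronglyMeasurable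
    (Filter.Eventually.of_forall fun p => hC p.2)

lemma integral_mul_resolventDensity {c : ℝ} (hc : 0 < c) {F : ℝ → ℂ} (hF : Continuous F)
    {C : ℝ} (hC : ∀ u, ‖F u‖ ≤ C) :
    ∫ p, F p.2 * (resolventDensity c p : ℂ) ∂halfPlaneMeasure =
      ∫ y in Set.Ioi (0 : ℝ), ((Real.exp (-c * y) : ℝ) : ℂ) *
        ∫ u : ℝ, F u * (heatKernel y u : ℂ) := by
  rw [halfPlaneMeasure, integral_prod _ (integrable_mul_resolventDensity hc hF hC)]
  refine integral_congr_ae (Filter.Eventually.of_forall fun y => ?_)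
  simp only [resolventDensity]
  rw [← integral_const_mul]
  congr 1 with u
  push_cast
  ring

lemma continuous_exp_neg_I_mul : Continuous fun u : ℝ => Complex.exp (-Complex.I * (u : ℂ)) := by
  fun_prop

lemma integral_exp_pow_mul_resolventDensity {c : ℝ} (hc : 0 < c) (k : ℕ) :
    ∫ p, Complex.exp (-Complex.I * (p.2 : ℂ)) ^ k * (resolventDensity c p : ℂ)
      ∂halfPlaneMeasure = (((c + (k : ℝ) ^ 2 / 2)⁻¹ : ℝ) : ℂ) := by
  have hpos : 0 < c + (k : ℝ) ^ 2 / 2 := by positivity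
  rw [integral_mul_resolventDensity hc
    (F := fun u : ℝ => Complex.exp (-Complex.I * (u : ℂ)) ^ k) (C := 1)
    (continuous_exp_neg_I_mul.pow k) (fun u => by rw [norm_pow, norm_exp_neg_I_mul, one_pow])]
  have h := integral_exp_mul_Ioi (neg_lt_zero.2 hpos) 0
  rw [mul_zero, Real.exp_zero, neg_div_neg_eq, one_div] at h
  rw [← h, ← integral_complex_ofReal]
  refine setIntegral_congr_fun measurableSet_Ioi fun y hy => ?_
  rw [integral_exp_pow_mul_heatKernel hy, ← Complex.ofReal_mul, ← Real.exp_add]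
  congr 2
  ring

/-- The Taylor coefficients of a function in the disk algebra are bounded. -/
lemma exists_norm_taylorCoeff_le {f : ℂ → ℂ} {a : ℕ → ℂ}
    (hf_an : DifferentiableOn ℂ f (Metric.ball (0 : ℂ) 1))
    (hf_cont : ContinuousOn f (Metric.closedBall (0 : ℂ) 1))
    (hf_taylor : ∀ z ∈ Metric.ball (0 : ℂ) 1, HasSum (fun k : ℕ => a k * z ^ k) (f z)) :
    ∃ B : ℝ, ∀ k, ‖a k‖ ≤ B := by
  have hd : DiffContOnCl ℂ f (Metric.ball (0 : ℂ) ((1 : NNReal) : ℝ)) :=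
    ⟨by simpa using hf_an, by simpa [closure_ball] using hf_cont⟩
  have h1 := (hd.hasFPowerSeriesOnBall one_pos).hasFPowerSeriesAt
  have h2 : HasFPowerSeriesAt f (FormalMultilinearSeries.ofScalars ℂ a) 0 := by
    rw [hasFPowerSeriesAt_iff]
    filter_upwards [Metric.ball_mem_nhds (0 : ℂ) one_pos] with w hw
    simpa [FormalMultilinearSeries.coeff_ofScalars, mul_comm] using hf_taylor w hw
  refine ⟨(2 * Real.pi)⁻¹ * ∫ t in 0..2 * Real.pi, ‖f (circleMap 0 1 t)‖, fun k => ?_⟩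
  have h3 := norm_cauchyPowerSeries_le f 0 ((1 : NNReal) : ℝ) k
  rw [h1.eq_formalMultilinearSeries h2, FormalMultilinearSeries.norm_apply_eq_norm_coef,
    FormalMultilinearSeries.coeff_ofScalars] at h3
  simpa using h3

lemma summable_inv_add_sq_div_two {c : ℝ} (hc : 0 < c) :
    Summable fun k : ℕ => (c + (k : ℝ) ^ 2 / 2)⁻¹ := by
  have h : Summable fun k : ℕ => 2 * ((k : ℝ) ^ 2)⁻¹ :=
    (Real.summable_nat_pow_inv.2 one_lt_two).mul_left 2
  refine (summable_nat_add_iff 1).1 (Summable.of_nonneg_of_le (fun k => by positivity)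
    (fun k => ?_) ((summable_nat_add_iff 1).2 h))
  rw [← div_eq_mul_inv, ← one_div, div_le_div_iff₀ (by positivity) (by positivity)]
  linarith

lemma norm_coeff_mul_pow_mul_inv_le {a : ℕ → ℂ} {B : ℝ} (hB : ∀ k, ‖a k‖ ≤ B) {c : ℝ}
    (hc : 0 < c) {z : ℂ} (hz : ‖z‖ ≤ 1) (k : ℕ) :
    ‖a k * z ^ k * (((c + (k : ℝ) ^ 2 / 2)⁻¹ : ℝ) : ℂ)‖ ≤ B * (c + (k : ℝ) ^ 2 / 2)⁻¹ := by
  have hpos : 0 < (c + (k : ℝ) ^ 2 / 2)⁻¹ := by positivity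
  rw [norm_mul, norm_mul, norm_pow, Complex.norm_of_nonneg hpos.le]
  gcongr
  exact (mul_le_of_le_one_right (norm_nonneg _) (pow_le_one₀ (norm_nonneg _) hz)).trans (hB k)

lemma hasSum_resolvent_of_norm_lt_one {f : ℂ → ℂ} {a : ℕ → ℂ}
    (hf_taylor : ∀ z ∈ Metric.ball (0 : ℂ) 1, HasSum (fun k : ℕ => a k * z ^ k) (f z))
    {B : ℝ} (hB : ∀ k, ‖a k‖ ≤ B) {c : ℝ} (hc : 0 < c) {z : ℂ} (hz : ‖z‖ < 1) :
    HasSum (fun k : ℕ => a k * z ^ k * (((c + (k : ℝ) ^ 2 / 2)⁻¹ : ℝ) : ℂ))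
      (∫ p, f (z * Complex.exp (-Complex.I * (p.2 : ℂ))) * (resolventDensity c p : ℂ)
        ∂halfPlaneMeasure) := by
  set F : ℕ → ℝ × ℝ → ℂ := fun k p => a k * z ^ k *
    (Complex.exp (-Complex.I * (p.2 : ℂ)) ^ k * (resolventDensity c p : ℂ)) with hFdef
  have hF : ∀ k, Integrable (F k) halfPlaneMeasure := fun k =>
    (integrable_mul_resolventDensity hc (F := fun u : ℝ => Complex.exp (-Complex.I * (u : ℂ)) ^ k)
      (C := 1) (continuous_exp_neg_I_mul.pow k)
      (fun u => by rw [norm_pow, norm_exp_neg_I_mul, one_pow])).const_mul _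
  have hnorm : ∀ k, ∫ p, ‖F k p‖ ∂halfPlaneMeasure =
      ‖a k‖ * ‖z‖ ^ k * ∫ p, resolventDensity c p ∂halfPlaneMeasure := fun k => by
    rw [← integral_const_mul]
    congr 1 with p
    simp only [hFdef, norm_mul, norm_pow, norm_exp_neg_I_mul, one_pow, one_mul,
      Complex.norm_of_nonneg (resolventDensity_nonneg c p)]
  have hsum : Summable fun k => ∫ p, ‖F k p‖ ∂halfPlaneMeasure := by
    simp only [hnorm]
    refine Summable.mul_right _ (Summable.of_nonneg_of_le (fun k => by positivity)
      (fun k => ?_) ((summable_geometric_of_lt_one (norm_nonneg z) hz).mul_left B))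
    gcongr
    exact hB k
  have hint : ∀ k, ∫ p, F k p ∂halfPlaneMeasure =
      a k * z ^ k * (((c + (k : ℝ) ^ 2 / 2)⁻¹ : ℝ) : ℂ) := fun k => by
    rw [integral_const_mul, integral_exp_pow_mul_resolventDensity hc]
  have htsum : ∀ p : ℝ × ℝ, ∑' k, F k p =
      f (z * Complex.exp (-Complex.I * (p.2 : ℂ))) * (resolventDensity c p : ℂ) := fun p => by
    have h := (hf_taylor (z * Complex.exp (-Complex.I * (p.2 : ℂ)))
      (by rwa [mem_ball_zero_iff, norm_mul_exp_neg_I_mul])).mul_right (resolventDensity c p : ℂ)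
    refine Eq.trans (tsum_congr fun k => ?_) h.tsum_eq
    simp only [hFdef]
    ring
  simpa only [hint, htsum] using hasSum_integral_of_summable_integral_norm hF hsum

lemma continuous_comp_mul_exp {f : ℂ → ℂ}
    (hf_cont : ContinuousOn f (Metric.closedBall (0 : ℂ) 1)) {z : ℂ} (hz : ‖z‖ ≤ 1) :
    Continuous fun u : ℝ => f (z * Complex.exp (-Complex.I * (u : ℂ))) :=
  hf_cont.comp_continuous (by fun_prop)
    fun u => by rwa [mem_closedBall_zero_iff, norm_mul_exp_neg_I_mul]

lemma tsum_resolvent_eq {f : ℂ → ℂ} {a : ℕ → ℂ}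
    (hf_cont : ContinuousOn f (Metric.closedBall (0 : ℂ) 1))
    (hf_taylor : ∀ z ∈ Metric.ball (0 : ℂ) 1, HasSum (fun k : ℕ => a k * z ^ k) (f z))
    {B : ℝ} (hB : ∀ k, ‖a k‖ ≤ B) {c : ℝ} (hc : 0 < c) {z : ℂ} (hz : ‖z‖ ≤ 1) :
    ∑' k : ℕ, a k * z ^ k * (((c + (k : ℝ) ^ 2 / 2)⁻¹ : ℝ) : ℂ) =
      ∫ p, f (z * Complex.exp (-Complex.I * (p.2 : ℂ))) * (resolventDensity c p : ℂ)
        ∂halfPlaneMeasure := by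
  obtain ⟨C, hC⟩ := (isCompact_closedBall (0 : ℂ) 1).exists_bound_of_continuousOn hf_cont
  have hC' : ∀ w ∈ Metric.closedBall (0 : ℂ) 1, ∀ u : ℝ,
      ‖f (w * Complex.exp (-Complex.I * (u : ℂ)))‖ ≤ C := fun w hw u =>
    hC _ (by rwa [mem_closedBall_zero_iff, norm_mul_exp_neg_I_mul, ← mem_closedBall_zero_iff])
  have hS : ContinuousOn (fun w : ℂ => ∑' k : ℕ, a k * w ^ k *
      (((c + (k : ℝ) ^ 2 / 2)⁻¹ : ℝ) : ℂ)) (Metric.closedBall 0 1) :=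
    continuousOn_tsum (fun k => by fun_prop) ((summable_inv_add_sq_div_two hc).mul_left B)
      fun k w hw => norm_coeff_mul_pow_mul_inv_le hB hc (mem_closedBall_zero_iff.1 hw) k
  have hT : ContinuousOn (fun w : ℂ => ∫ p, f (w * Complex.exp (-Complex.I * (p.2 : ℂ))) *
      (resolventDensity c p : ℂ) ∂halfPlaneMeasure) (Metric.closedBall 0 1) := by
    refine continuousOn_of_dominated (bound := fun p => C * resolventDensity c p)
      (fun w hw => ?_) (fun w hw => Filter.Eventually.of_forall fun p => ?_)
      ((integrable_resolventDensity hc).const_mul C)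
      (Filter.Eventually.of_forall fun p => ?_)
    · exact (integrable_mul_resolventDensity hc
        (continuous_comp_mul_exp hf_cont (mem_closedBall_zero_iff.1 hw))
        (hC' w hw)).aestronglyMeasurable
    · rw [norm_mul, Complex.norm_of_nonneg (resolventDensity_nonneg c p)]
      exact mul_le_mul_of_nonneg_right (hC' w hw p.2) (resolventDensity_nonneg c p)
    · refine (hf_cont.comp (by fun_prop) fun w hw => ?_).mul continuousOn_const
      rwa [mem_closedBall_zero_iff, norm_mul_exp_neg_I_mul, ← mem_closedBall_zero_iff]
  refine Set.EqOn.of_subset_closure (s := Metric.ball (0 : ℂ) 1) (fun w hw => ?_) hS hT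
    Metric.ball_subset_closedBall (closure_ball (0 : ℂ) one_ne_zero).ge
    (mem_closedBall_zero_iff.2 hz)
  exact (hasSum_resolvent_of_norm_lt_one hf_taylor hB hc (mem_ball_zero_iff.1 hw)).tsum_eq

/-- Subordination: the Laplace transform in time of the heat semigroup run at a random time with
density `m · t` is a resolvent of the heat semigroup. -/
lemma laplace_integral_subordinated_heatKernel
    {m : ℝ → ℝ → ℝ} (hm_meas : Measurable (Function.uncurry m))
    (hm_nonneg : ∀ s t : ℝ, 0 ≤ m s t) {θ b c : ℝ} (hb : 0 < b) (hc : 0 < c)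
    (hm_laplace : ∀ s : ℝ, 0 < s →
      ∫ t in Set.Ioi (0 : ℝ), Real.exp (-θ * t) * m s t = b * Real.exp (-s * c))
    {F : ℝ → ℂ} (hF : Continuous F) {C : ℝ} (hC : ∀ u, ‖F u‖ ≤ C) :
    ∫ t in Set.Ioi (0 : ℝ), ((Real.exp (-θ * t) : ℝ) : ℂ) *
        ∫ u : ℝ, F u * ((∫ y in Set.Ioi (0 : ℝ), heatKernel y u * m y t : ℝ) : ℂ) =
      b * ∫ p, F p.2 * (resolventDensity c p : ℂ) ∂halfPlaneMeasure := by
  set μ₀ : Measure ℝ := volume.restrict (Set.Ioi (0 : ℝ))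
  set A : ℝ × (ℝ × ℝ) → ℝ := fun q =>
    Real.exp (-θ * q.2.1) * m q.1 q.2.1 * heatKernel q.1 q.2.2 with hA
  have hA_nonneg : ∀ q, 0 ≤ A q := fun q => mul_nonneg
    (mul_nonneg (Real.exp_pos _).le (hm_nonneg _ _)) (heatKernel_nonneg _ _)
  have hA_meas : Measurable A := by
    have h1 : Measurable fun q : ℝ × (ℝ × ℝ) => m q.1 q.2.1 :=
      hm_meas.comp (by fun_prop : Measurable fun q : ℝ × (ℝ × ℝ) => (q.1, q.2.1))
    have h2 : Measurable fun q : ℝ × (ℝ × ℝ) => heatKernel q.1 q.2.2 :=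
      measurable_uncurry_heatKernel.comp
        (by fun_prop : Measurable fun q : ℝ × (ℝ × ℝ) => (q.1, q.2.2))
    exact Measurable.mul (Measurable.mul (by fun_prop) h1) h2
  have hA_int : Integrable A (μ₀.prod (μ₀.prod volume)) := by
    refine (integrable_prod_iff hA_meas.aestronglyMeasurable).2 ⟨?_, ?_⟩
    · filter_upwards [ae_restrict_mem measurableSet_Ioi] with y hy
      refine Integrable.mul_prod (f := fun t => Real.exp (-θ * t) * m y t)
        (not_imp_comm.1 integral_undef ?_) (integrable_heatKernel hy)
      rw [hm_laplace y hy]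
      positivity
    · refine ((integrableOn_exp_mul_Ioi (neg_lt_zero.2 hc) 0).const_mul b).congr ?_
      filter_upwards [ae_restrict_mem measurableSet_Ioi] with y hy
      simp only [Real.norm_of_nonneg (hA_nonneg _)]
      refine Eq.symm ((integral_prod_mul (fun t => Real.exp (-θ * t) * m y t)
        (heatKernel y)).trans ?_)
      rw [integral_heatKernel hy, mul_one, hm_laplace y hy, neg_mul, neg_mul, mul_comm y c]
  have hH_int : Integrable (fun q : ℝ × (ℝ × ℝ) => F q.2.2 * (A q : ℂ))
      (μ₀.prod (μ₀.prod volume)) :=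
    hA_int.ofReal.bdd_mul (hF.comp (by fun_prop)).aestronglyMeasurable
      (Filter.Eventually.of_forall fun q => hC q.2.2)
  have hswap := integral_integral_swap (f := fun y p => F p.2 * (A (y, p) : ℂ)) hH_int
  rw [integral_prod _ hH_int.integral_prod_right] at hswap
  rw [integral_mul_resolventDensity hc hF hC, ← integral_const_mul]
  calc _ = _ := ?_
    _ = _ := hswap.symm
    _ = _ := ?_
  · congr 1 with t
    rw [← integral_const_mul]
    congr 1 with u
    rw [← integral_complex_ofReal, ← integral_const_mul, ← integral_const_mul]
    congr 1 with y
    simp only [hA]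
    push_cast
    ring
  · refine setIntegral_congr_fun measurableSet_Ioi fun y hy => ?_
    have h := integral_prod_mul (μ := μ₀) (ν := volume)
      (fun t => ((Real.exp (-θ * t) * m y t : ℝ) : ℂ)) (fun u => F u * (heatKernel y u : ℂ))
    rw [integral_complex_ofReal, hm_laplace y hy] at h
    refine Eq.trans ?_ (h.trans ?_)
    · congr 1 with p
      simp only [hA]
      push_cast
      ring
    · rw [neg_mul, neg_mul, mul_comm y c]
      push_cast
      ring

/-- for a family of probability densities `m(·, t)` on `(0,∞)` whose
time-Laplace transform is `(g(θ)/θ) e^{-s g(θ)}`, and `f ∈ A(D)` with Taylor coefficients `a`,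
the time-Laplace transform of `t ↦ ∫_ℝ f(z e^{-iu}) ℓ_g(u,t) du` equals
`∑ₖ aₖ zᵏ (g(θ)/θ)/(g(θ) + k²/2)`, the series converging absolutely.
Here `ℓ_g(u,t) = ∫_0^∞ (2πy)^{-1/2} e^{-u²/(2y)} m(y,t) dy`. -/
theorem laplace_transform_of_subordinated_operator
    (g : ℝ → ℝ) (hg_pos : ∀ θ : ℝ, 0 < θ → 0 < g θ)
    (m : ℝ → ℝ → ℝ) (hm_meas : Measurable (Function.uncurry m))
    (hm_nonneg : ∀ s t : ℝ, 0 ≤ m s t)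
    (hm_prob : ∀ t : ℝ, 0 < t → ∫ s in Set.Ioi (0 : ℝ), m s t = 1)
    (hm_laplace : ∀ s : ℝ, 0 < s → ∀ θ : ℝ, 0 < θ →
      ∫ t in Set.Ioi (0 : ℝ), Real.exp (-θ * t) * m s t = g θ / θ * Real.exp (-s * g θ))
    (f : ℂ → ℂ) (a : ℕ → ℂ)
    (hf_an : DifferentiableOn ℂ f (Metric.ball (0 : ℂ) 1))
    (hf_cont : ContinuousOn f (Metric.closedBall (0 : ℂ) 1))
    (hf_taylor : ∀ z ∈ Metric.ball (0 : ℂ) 1, HasSum (fun k : ℕ => a k * z ^ k) (f z))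
    (θ : ℝ) (hθ : 0 < θ) (z : ℂ) (hz : ‖z‖ ≤ 1) :
    Summable (fun k : ℕ =>
      ‖a k * z ^ k * ((g θ / θ / (g θ + (k : ℝ) ^ 2 / 2) : ℝ) : ℂ)‖) ∧
    HasSum (fun k : ℕ => a k * z ^ k * ((g θ / θ / (g θ + (k : ℝ) ^ 2 / 2) : ℝ) : ℂ))
      (∫ t in Set.Ioi (0 : ℝ), ((Real.exp (-θ * t) : ℝ) : ℂ) *
        ∫ u : ℝ, f (z * Complex.exp (-Complex.I * (u : ℂ))) *
          ((∫ y in Set.Ioi (0 : ℝ),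
            (Real.sqrt (2 * Real.pi * y))⁻¹ * Real.exp (-u ^ 2 / (2 * y)) * m y t : ℝ) : ℂ)) := by
  have hg := hg_pos θ hθ
  obtain ⟨B, hB⟩ := exists_norm_taylorCoeff_le hf_an hf_cont hf_taylor
  obtain ⟨C, hC⟩ := (isCompact_closedBall (0 : ℂ) 1).exists_bound_of_continuousOn hf_cont
  have hsum : Summable fun k : ℕ =>
      ‖a k * z ^ k * (((g θ + (k : ℝ) ^ 2 / 2)⁻¹ : ℝ) : ℂ)‖ :=
    Summable.of_nonneg_of_le (fun k => norm_nonneg _) (norm_coeff_mul_pow_mul_inv_le hB hg hz)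
      ((summable_inv_add_sq_div_two hg).mul_left B)
  have hterm : (fun k : ℕ => a k * z ^ k * ((g θ / θ / (g θ + (k : ℝ) ^ 2 / 2) : ℝ) : ℂ)) =
      fun k : ℕ => ((g θ / θ : ℝ) : ℂ) *
        (a k * z ^ k * (((g θ + (k : ℝ) ^ 2 / 2)⁻¹ : ℝ) : ℂ)) := by
    ext k
    rw [div_eq_mul_inv (g θ / θ), Complex.ofReal_mul]
    ring
  have hlap := laplace_integral_subordinated_heatKernel hm_meas hm_nonneg (div_pos hg hθ) hg
    (fun s hs => hm_laplace s hs θ hθ) (continuous_comp_mul_exp hf_cont hz)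
    (fun u => hC _ (by rwa [mem_closedBall_zero_iff, norm_mul_exp_neg_I_mul]))
  simp only [heatKernel] at hlap
  have hall : HasSum (fun k : ℕ => a k * z ^ k * ((g θ / θ / (g θ + (k : ℝ) ^ 2 / 2) : ℝ) : ℂ))
      (((g θ / θ : ℝ) : ℂ) *
        ∑' k : ℕ, a k * z ^ k * (((g θ + (k : ℝ) ^ 2 / 2)⁻¹ : ℝ) : ℂ)) := by
    rw [hterm]
    exact hsum.of_norm.hasSum.mul_left _
  refine ⟨hall.summable.norm, ?_⟩
  rw [hlap, ← tsum_resolvent_eq hf_cont hf_taylor hB hg hz]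
  exact hall
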